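/- arXiv:2511.00914 — 2 statements merged into one kernel-verified Lean document; each statement's English description precedes it below -/
import Mathlib

section
/- If h : N₂ → ℂ is a light weight and u is a vertex reachable from 1 by a walk all of whose edges have nonzero weight, then the series Σ_{v∈ℕ∖{u}} h({u,v}) converges absolutely. -/
open Filter

/-- The weight of a walk `⟨w 0, …, w n⟩` in `K_ℕ`: the product of the edge weights. -/
noncomputable def wt (h : Sym2 ℕ → ℂ) {n : ℕ} (w : Fin (n + 1) → ℕ) : ℂ :=
  ∏ i : Fin n, h s(w i.castSucc, w i.succ)

/-- `w` is a walk: consecutive vertices are distinct. -/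
def IsWalk {n : ℕ} (w : Fin (n + 1) → ℕ) : Prop :=
  ∀ i : Fin n, w i.castSucc ≠ w i.succ

/-- `W n`: walks of length `n` in `K_ℕ` starting at vertex `1`. -/
def W (n : ℕ) : Set (Fin (n + 1) → ℕ) :=
  {w | w 0 = 1 ∧ IsWalk w}

/-- A weight `h` is light if for every `n` the series of walk weights over `W n`
converges absolutely. -/
def Light (h : Sym2 ℕ → ℂ) : Prop :=
  ∀ n : ℕ, Summable fun w : W n => ‖wt h w.1‖

/-- `u` belongs to `V(h,n)`: it is reachable from `1` by a walk of length at most `n`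
all of whose edges have nonzero weight. -/
def ReachableIn (h : Sym2 ℕ → ℂ) (n : ℕ) (u : ℕ) : Prop :=
  ∃ m, m ≤ n ∧ ∃ w : Fin (m + 1) → ℕ, w 0 = 1 ∧ IsWalk w ∧
    (∀ i : Fin m, h s(w i.castSucc, w i.succ) ≠ 0) ∧ w (Fin.last m) = u

/-- `u ∈ V(h)`: reachable from `1` by a walk with all edge weights nonzero. -/
def Reachable (h : Sym2 ℕ → ℂ) (u : ℕ) : Prop :=
  ∃ n, ReachableIn h n u

/-- If `h` is light and `u ∈ V(h)`, then the series `Σ_{v∈ℕ∖{u}} h({u,v})` converges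
absolutely. -/
theorem stmt5 (h : Sym2 ℕ → ℂ) (hlight : Light h) (u : ℕ) (hu : Reachable h u) :
    Summable fun v : {v : ℕ // v ≠ u} => ‖h s(u, (v : ℕ))‖ := by
  obtain ⟨n, m, -, w, hw0, hw, hne, rfl⟩ := hu
  have hwt : ‖wt h w‖ ≠ 0 := by
    rw [norm_ne_zero_iff]
    exact Finset.prod_ne_zero_iff.mpr fun i _ => hne i
  let g : {v : ℕ // v ≠ w (Fin.last m)} → W (m + 1) := fun v =>
    ⟨Fin.snoc (α := fun _ => ℕ) w v.1, by
      refine ⟨?_, ?_⟩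
      · rw [← Fin.castSucc_zero, Fin.snoc_castSucc, hw0]
      · intro i
        refine Fin.lastCases ?_ (fun j => ?_) i
        · rw [Fin.snoc_castSucc, Fin.succ_last, Fin.snoc_last]
          exact v.2.symm
        · rw [Fin.snoc_castSucc, Fin.succ_castSucc, Fin.snoc_castSucc]
          exact hw j⟩
  have hg : Function.Injective g := by
    intro a b hab
    have h1 := congrFun (congrArg Subtype.val hab) (Fin.last (m + 1))
    simp only [g, Fin.snoc_last] at h1
    exact Subtype.ext h1
  have hs := (hlight (m + 1)).comp_injective hg
  have heq : ((fun w : W (m + 1) => ‖wt h w.1‖) ∘ g) =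
      fun v : {v : ℕ // v ≠ w (Fin.last m)} => ‖wt h w‖ * ‖h s(w (Fin.last m), (v : ℕ))‖ := by
    funext v
    simp only [Function.comp, g, wt]
    rw [Fin.prod_univ_castSucc, norm_mul]
    simp only [Fin.snoc_castSucc, Fin.succ_castSucc, Fin.succ_last, Fin.snoc_last]
  rw [heq] at hs
  exact (summable_mul_left_iff hwt).mp hs
end

section
/- Let h : N₂ → ℂ be a convex light weight, with B_h(x) = Σ h(W_b(n))xⁿ and C_h(x) = Σ h(W_c(n))xⁿ. If the partial sums of the coefficients of B_h and C_h converge (B_h(1)₁ and C_h(1)₁ exist), then B_h(1)₁ ≠ 0 and lim_{n→∞} h(W(1,n)) = 1 − 1/B_h(1)₁. -/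
open Filter

/-- A light weight is convex if for every vertex `u ∈ V(h)` the weights of edges at `u`
sum to `1`. -/
def ConvexWeight (h : Sym2 ℕ → ℂ) : Prop :=
  ∀ u : ℕ, Reachable h u → HasSum (fun v : {v : ℕ // v ≠ u} => h s(u, (v : ℕ))) 1

/-- `W(1,n)`: walks in `W n` that visit vertex `1` at a step `i > 0`. -/
def W1 (n : ℕ) : Set (Fin (n + 1) → ℕ) :=
  {w | w ∈ W n ∧ ∃ i : Fin (n + 1), i ≠ 0 ∧ w i = 1}

/-- `W_b(n)`: walks of length `n` starting and ending at `1`. -/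
def Wb (n : ℕ) : Set (Fin (n + 1) → ℕ) :=
  {w | w ∈ W n ∧ w (Fin.last n) = 1}

/-- `W_c(n)`: walks of positive length `n` starting and ending at `1` and avoiding `1`
strictly in between. -/
def Wc (n : ℕ) : Set (Fin (n + 1) → ℕ) :=
  {w | w ∈ Wb n ∧ 0 < n ∧ ∀ i : Fin (n + 1), i ≠ 0 → i ≠ Fin.last n → w i ≠ 1}

/-- `aC h n = h(W(1,n))`, the coefficient of `A_h(x)`. -/
noncomputable def aC (h : Sym2 ℕ → ℂ) (n : ℕ) : ℂ := ∑' w : W1 n, wt h w.1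

/-- `bC h n = h(W_b(n))`, the coefficient of `B_h(x)`. -/
noncomputable def bC (h : Sym2 ℕ → ℂ) (n : ℕ) : ℂ := ∑' w : Wb n, wt h w.1

/-- `cC h n = h(W_c(n))`, the coefficient of `C_h(x)`. -/
noncomputable def cC (h : Sym2 ℕ → ℂ) (n : ℕ) : ℂ := ∑' w : Wc n, wt h w.1

/-- `dC h n = h(W(n))`, the coefficient of `D_h(x)`. -/
noncomputable def dC (h : Sym2 ℕ → ℂ) (n : ℕ) : ℂ := ∑' w : W n, wt h w.1

/-- Append a vertex to a walk. -/
def sn {n : ℕ} (w : Fin (n + 1) → ℕ) (v : ℕ) : Fin (n + 1 + 1) → ℕ :=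
  Fin.snoc (α := fun _ => ℕ) w v

lemma sn_castSucc {n : ℕ} (w : Fin (n + 1) → ℕ) (v : ℕ) (i : Fin (n + 1)) :
    sn w v i.castSucc = w i := by
  simp [sn]

lemma sn_last {n : ℕ} (w : Fin (n + 1) → ℕ) (v : ℕ) :
    sn w v (Fin.last (n + 1)) = v := by
  simp [sn]

lemma sn_zero {n : ℕ} (w : Fin (n + 1) → ℕ) (v : ℕ) : sn w v 0 = w 0 :=
  sn_castSucc w v 0

lemma exists_sn {n : ℕ} (w : Fin (n + 1 + 1) → ℕ) : ∃ w' v, w = sn w' v :=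
  ⟨fun i => w i.castSucc, w (Fin.last _), (Fin.snoc_init_self (α := fun _ => ℕ) w).symm⟩

lemma sn_inj {n : ℕ} {w w' : Fin (n + 1) → ℕ} {v v' : ℕ} (h : sn w v = sn w' v') :
    w = w' ∧ v = v' := by
  constructor
  · funext i
    rw [← sn_castSucc w v i, h, sn_castSucc]
  · rw [← sn_last w v, h, sn_last]

/-- Pairs (walk, new vertex) versus walks of length one more. -/
noncomputable def snEquiv (n : ℕ) : (Fin (n + 1) → ℕ) × ℕ ≃ (Fin (n + 1 + 1) → ℕ) :=
  Equiv.ofBijective (fun p => sn p.1 p.2)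
    ⟨fun p q h => Prod.ext (sn_inj h).1 (sn_inj h).2,
     fun w => by obtain ⟨w', v, rfl⟩ := exists_sn w; exact ⟨(w', v), rfl⟩⟩

/-- Walks extending a walk of `S` by one step. -/
def ext1 {n : ℕ} (S : Set (Fin (n + 1) → ℕ)) : Set (Fin (n + 1 + 1) → ℕ) :=
  {w | (fun i : Fin (n + 1) => w i.castSucc) ∈ S ∧
    w (Fin.last n).castSucc ≠ w (Fin.last (n + 1))}

/-- Walks ending in `v`. -/
def endAt (n : ℕ) (v : ℕ) : Set (Fin (n + 1) → ℕ) := {w | w (Fin.last n) = v}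

lemma sn_mem_ext1 {n : ℕ} (S : Set (Fin (n + 1) → ℕ)) (w : Fin (n + 1) → ℕ) (v : ℕ) :
    sn w v ∈ ext1 S ↔ w ∈ S ∧ w (Fin.last n) ≠ v := by
  simp [ext1, sn_castSucc, sn_last]

lemma sn_mem_endAt {n : ℕ} (w : Fin (n + 1) → ℕ) (v u : ℕ) :
    sn w v ∈ endAt (n + 1) u ↔ v = u := by
  simp [endAt, sn_last]

lemma sn_mem_W {n : ℕ} (w : Fin (n + 1) → ℕ) (v : ℕ) :
    sn w v ∈ W (n + 1) ↔ w ∈ W n ∧ w (Fin.last n) ≠ v := by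
  have : ∀ i : Fin n, sn w v (i.castSucc.succ) = w i.succ := fun i => by
    rw [Fin.succ_castSucc, sn_castSucc]
  simp only [W, IsWalk, Set.mem_ofPred_eq, sn_zero, sn_castSucc]
  rw [Fin.forall_fin_succ']
  simp only [this, Fin.succ_last, sn_last, and_assoc]

lemma sn_mem_W1 {n : ℕ} (w : Fin (n + 1) → ℕ) (v : ℕ) :
    sn w v ∈ W1 (n + 1) ↔ (w ∈ W n ∧ w (Fin.last n) ≠ v) ∧ (w ∈ W1 n ∨ v = 1) := by
  simp only [W1, Set.mem_ofPred_eq, sn_mem_W]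
  rw [Fin.exists_fin_succ']
  simp only [sn_castSucc, sn_last, ne_eq, Fin.castSucc_eq_zero_iff, Fin.last_eq_zero_iff]
  simp
  intro h1 _
  simp [h1]

/-- Walks that never come back to `1`. -/
def Q (n : ℕ) : Set (Fin (n + 1) → ℕ) := W n \ W1 n

lemma W_succ (n : ℕ) : W (n + 1) = ext1 (W n) := by
  ext w
  obtain ⟨w, v, rfl⟩ := exists_sn w
  rw [sn_mem_W, sn_mem_ext1]

lemma W1_sub (n : ℕ) : W1 n ⊆ W n := fun _ h => h.1

lemma W1_succ (n : ℕ) : W1 (n + 1) = ext1 (W1 n) ∪ (ext1 (Q n) ∩ endAt (n + 1) 1) := by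
  ext w
  obtain ⟨w, v, rfl⟩ := exists_sn w
  have := @W1_sub n w
  rw [Set.mem_union, Set.mem_inter_iff, sn_mem_W1, sn_mem_ext1, sn_mem_ext1, sn_mem_endAt, Q,
    Set.mem_sdiff]
  tauto

lemma Wc_succ (n : ℕ) : Wc (n + 1) = ext1 (Q n) ∩ endAt (n + 1) 1 := by
  ext w
  obtain ⟨w, v, rfl⟩ := exists_sn w
  rw [Set.mem_inter_iff, sn_mem_ext1, sn_mem_endAt, Q, Set.mem_sdiff]
  simp only [Wc, Wb, Set.mem_ofPred_eq, sn_mem_W, sn_last, W1]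
  rw [Fin.forall_fin_succ']
  simp only [sn_castSucc, sn_last, ne_eq, Fin.castSucc_eq_zero_iff, not_exists, not_and]
  simp [Fin.castSucc_ne_last]
  tauto

lemma Q_succ (n v : ℕ) (hv : v ≠ 1) :
    Q (n + 1) ∩ endAt (n + 1) v = ext1 (Q n) ∩ endAt (n + 1) v := by
  ext w
  obtain ⟨w, u, rfl⟩ := exists_sn w
  rw [Set.mem_inter_iff, Set.mem_inter_iff, sn_mem_ext1, sn_mem_endAt, Q, Q, Set.mem_sdiff,
    Set.mem_sdiff, sn_mem_W, sn_mem_W1]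
  have : u = v → u ≠ 1 := fun h => h ▸ hv
  tauto

lemma Q_succ_one (n : ℕ) : Q (n + 1) ∩ endAt (n + 1) 1 = ∅ := by
  ext w
  obtain ⟨w, u, rfl⟩ := exists_sn w
  rw [Set.mem_inter_iff, sn_mem_endAt, Q, Set.mem_sdiff, sn_mem_W, sn_mem_W1]
  simp only [Set.mem_empty_iff_false, iff_false]
  tauto

/-- The edge weight, with loops given weight zero. -/
noncomputable def hw (h : Sym2 ℕ → ℂ) (u v : ℕ) : ℂ := if u = v then 0 else h s(u, v)

lemma wt_sn (h : Sym2 ℕ → ℂ) {n : ℕ} (w : Fin (n + 1) → ℕ) (v : ℕ) :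
    wt h (sn w v) = wt h w * h s(w (Fin.last n), v) := by
  have : ∀ i : Fin n, sn w v (i.castSucc.succ) = w i.succ := fun i => by
    rw [Fin.succ_castSucc, sn_castSucc]
  unfold wt
  rw [Fin.prod_univ_castSucc]
  simp only [this, Fin.succ_last, sn_last, sn_castSucc]

lemma ind_sn (h : Sym2 ℕ → ℂ) {n : ℕ} (S : Set (Fin (n + 1) → ℕ)) (w : Fin (n + 1) → ℕ) (v : ℕ) :
    (ext1 S).indicator (wt h) (sn w v) = S.indicator (wt h) w * hw h (w (Fin.last n)) v := by
  classical
  rw [Set.indicator_apply, Set.indicator_apply, sn_mem_ext1, hw, wt_sn]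
  by_cases h1 : w ∈ S <;> by_cases h2 : w (Fin.last n) = v <;> simp [h1, h2]

/-- Total weight of a set of walks. -/
noncomputable def tot (h : Sym2 ℕ → ℂ) {n : ℕ} (S : Set (Fin (n + 1) → ℕ)) : ℂ :=
  ∑' w, S.indicator (wt h) w

lemma summ (h : Sym2 ℕ → ℂ) (hl : Light h) {n : ℕ} {S : Set (Fin (n + 1) → ℕ)} (hS : S ⊆ W n) :
    Summable (S.indicator (wt h)) := by
  have h1 : Summable ((W n).indicator (wt h)) :=
    summable_subtype_iff_indicator.1 (Summable.of_norm (hl n))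
  have := h1.indicator S
  rwa [Set.indicator_indicator, Set.inter_eq_left.2 hS] at this

lemma ext1_sub {n : ℕ} {S : Set (Fin (n + 1) → ℕ)} (hS : S ⊆ W n) : ext1 S ⊆ W (n + 1) := by
  rw [W_succ]
  exact fun w hw => ⟨hS hw.1, hw.2⟩

lemma step_hasSum (h : Sym2 ℕ → ℂ) (hl : Light h) {n : ℕ} {S : Set (Fin (n + 1) → ℕ)}
    (hS : S ⊆ W n) (v : ℕ) :
    HasSum (fun u => tot h (S ∩ endAt n u) * hw h u v) (tot h (ext1 S ∩ endAt (n + 1) v)) := by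
  classical
  have h1 : HasSum ((ext1 S ∩ endAt (n + 1) v).indicator (wt h))
      (tot h (ext1 S ∩ endAt (n + 1) v)) :=
    (summ h hl (Set.inter_subset_left.trans (ext1_sub hS))).hasSum
  have hinj : Function.Injective (fun w : Fin (n + 1) → ℕ => sn w v) :=
    fun w w' e => (sn_inj e).1
  rw [← hinj.hasSum_iff] at h1
  · have h2 := h1.tsum_fiberwise (fun w => w (Fin.last n))
    refine (funext fun u => ?_ : (fun u => tot h (S ∩ endAt n u) * hw h u v) = _) ▸ h2
    unfold tot
    rw [← tsum_mul_right, tsum_subtype ((fun w : Fin (n + 1) → ℕ => w (Fin.last n)) ⁻¹' {u})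
      ((ext1 S ∩ endAt (n + 1) v).indicator (wt h) ∘ fun w => sn w v)]
    refine tsum_congr fun w => ?_
    have e : (ext1 S ∩ endAt (n + 1) v).indicator (wt h) (sn w v)
        = S.indicator (wt h) w * hw h (w (Fin.last n)) v := by
      rw [← ind_sn, Set.indicator_apply, Set.indicator_apply]
      simp [sn_mem_endAt]
    rw [Set.indicator_apply, Set.indicator_apply, Function.comp_apply, e, Set.indicator_apply]
    by_cases h3 : w ∈ S <;> by_cases h4 : w (Fin.last n) = u <;> simp [h3, h4, endAt]
  · intro w hw
    rw [Set.indicator_apply, if_neg]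
    rintro ⟨-, h3⟩
    obtain ⟨w, u, rfl⟩ := exists_sn w
    rw [sn_mem_endAt] at h3
    exact hw ⟨w, by rw [h3]⟩

lemma conv_hw (h : Sym2 ℕ → ℂ) (hc : ConvexWeight h) (u : ℕ) (hu : Reachable h u) :
    HasSum (hw h u) 1 := by
  classical
  have h1 := hc u hu
  have h2 := (hasSum_subtype_iff_indicator (f := fun v => h s(u, v)) (s := {v | v ≠ u})).1 h1
  convert h2 using 1
  funext v
  rw [Set.indicator_apply, hw]
  by_cases e : u = v
  · simp [e]
  · simp [e, Ne.symm e]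

lemma tot_ext1 (h : Sym2 ℕ → ℂ) (hl : Light h) (hc : ConvexWeight h) {n : ℕ}
    {S : Set (Fin (n + 1) → ℕ)} (hS : S ⊆ W n) : tot h (ext1 S) = tot h S := by
  classical
  have h1 : HasSum ((ext1 S).indicator (wt h)) (tot h (ext1 S)) := (summ h hl (ext1_sub hS)).hasSum
  rw [← (snEquiv n).hasSum_iff] at h1
  have h2 : HasSum (S.indicator (wt h)) (tot h (ext1 S)) := by
    refine h1.prod_fiberwise fun w => ?_
    have e : (fun c => ((ext1 S).indicator (wt h) ∘ (snEquiv n)) (w, c)) =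
        fun c => S.indicator (wt h) w * hw h (w (Fin.last n)) c := by
      funext c
      exact ind_sn h S w c
    rw [e]
    by_cases h0 : S.indicator (wt h) w = 0
    · simp only [h0, zero_mul]
      exact hasSum_zero
    · have hwS : w ∈ S := Set.mem_of_indicator_ne_zero h0
      rw [Set.indicator_of_mem hwS] at h0
      have := (conv_hw h hc (w (Fin.last n)) ⟨n, n, le_rfl, w, (hS hwS).1, (hS hwS).2,
        fun i => (Finset.prod_ne_zero_iff.1 h0) i (Finset.mem_univ i), rfl⟩).mul_left
        (S.indicator (wt h) w)
      simpa using this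
  exact h2.tsum_eq.symm

lemma aC_eq_tot (h : Sym2 ℕ → ℂ) (n : ℕ) : aC h n = tot h (W1 n) := tsum_subtype _ _
lemma bC_eq_tot (h : Sym2 ℕ → ℂ) (n : ℕ) : bC h n = tot h (W n ∩ endAt n 1) := tsum_subtype _ _
lemma cC_eq_tot (h : Sym2 ℕ → ℂ) (n : ℕ) : cC h n = tot h (Wc n) := tsum_subtype _ _

lemma tot_empty (h : Sym2 ℕ → ℂ) (n : ℕ) : tot h (∅ : Set (Fin (n + 1) → ℕ)) = 0 := by
  simp [tot]

lemma Q_sub (n : ℕ) : Q n ⊆ W n := Set.sdiff_subset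

lemma W1_zero : W1 0 = ∅ := by
  ext w
  simp only [W1, Set.mem_ofPred_eq, Set.mem_empty_iff_false, iff_false]
  rintro ⟨-, i, hi, -⟩
  exact hi (Fin.ext (by simp))

lemma cC_zero (h : Sym2 ℕ → ℂ) : cC h 0 = 0 := by
  rw [cC_eq_tot, show Wc 0 = ∅ from Set.eq_empty_of_forall_notMem fun w hw => by
    exact absurd hw.2.1 (lt_irrefl 0), tot_empty]

lemma aC_eq (h : Sym2 ℕ → ℂ) (hl : Light h) (hc : ConvexWeight h) (n : ℕ) :
    aC h n = ∑ j ∈ Finset.range (n + 1), cC h j := by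
  induction n with
  | zero => simp [cC_zero, aC_eq_tot, W1_zero, tot_empty]
  | succ n ih =>
    rw [Finset.sum_range_succ, ← ih, aC_eq_tot, aC_eq_tot, cC_eq_tot, W1_succ, ← Wc_succ,
      ← tot_ext1 h hl hc (W1_sub n)]
    have hd : Disjoint (ext1 (W1 n)) (Wc (n + 1)) := by
      rw [Wc_succ]
      exact Set.disjoint_left.2 fun w hw hw' => hw'.1.1.2 hw.1
    unfold tot
    rw [Set.indicator_union_of_disjoint hd]
    exact Summable.tsum_add (summ h hl (ext1_sub (W1_sub n)))
      (summ h hl (fun w hw => hw.1.1))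

lemma W_zero_end (h : Sym2 ℕ → ℂ) (v : ℕ) : tot h (W 0 ∩ endAt 0 v) = if v = 1 then 1 else 0 := by
  classical
  unfold tot
  rw [tsum_eq_single (fun _ => 1)]
  · rw [Set.indicator_apply]
    by_cases hv : v = 1
    · simp [W, endAt, IsWalk, hv, wt]
    · simp [W, endAt, IsWalk, hv, Ne.symm hv]
  · intro w hw
    rw [Set.indicator_apply, if_neg]
    rintro ⟨h1, -⟩
    exact hw (funext fun i => by rw [show i = 0 from Fin.ext (by simp)]; exact h1.1)

lemma Q_zero : Q 0 = W 0 := by rw [Q, W1_zero, Set.sdiff_empty]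

lemma bC_zero (h : Sym2 ℕ → ℂ) : bC h 0 = 1 := by
  rw [bC_eq_tot, W_zero_end, if_pos rfl]

lemma pre_step (h : Sym2 ℕ → ℂ) (hl : Light h) (n : ℕ)
    (ih : ∀ v, tot h (W n ∩ endAt n v) =
      ∑ j ∈ Finset.range (n + 1), bC h j * tot h (Q (n - j) ∩ endAt (n - j) v)) (v : ℕ) :
    tot h (W (n + 1) ∩ endAt (n + 1) v) = ∑ j ∈ Finset.range (n + 1),
      bC h j * tot h (ext1 (Q (n - j)) ∩ endAt (n - j + 1) v) := by
  have h1 := step_hasSum h hl (le_refl (W n)) v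
  rw [← W_succ] at h1
  refine h1.unique ?_
  have h2 := hasSum_sum (s := Finset.range (n + 1)) fun j _ =>
    (step_hasSum h hl (Q_sub (n - j)) v).mul_left (bC h j)
  refine (funext fun u => ?_ : (fun u => tot h (W n ∩ endAt n u) * hw h u v) = _) ▸ h2
  rw [ih, Finset.sum_mul]
  exact Finset.sum_congr rfl fun j _ => by ring

lemma renewal_gen (h : Sym2 ℕ → ℂ) (hl : Light h) (n : ℕ) : ∀ v, tot h (W n ∩ endAt n v) =
      ∑ j ∈ Finset.range (n + 1), bC h j * tot h (Q (n - j) ∩ endAt (n - j) v) := by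
  induction n with
  | zero => intro v; simp [Q_zero, bC_zero]
  | succ n ih =>
    intro v
    have h1 := pre_step h hl n ih v
    rw [Finset.sum_range_succ, Nat.sub_self, Q_zero, W_zero_end]
    by_cases hv : v = 1
    · subst hv
      rw [← bC_eq_tot, if_pos rfl, mul_one, Finset.sum_eq_zero, zero_add]
      intro j hj
      have : n + 1 - j = (n - j) + 1 := by have := Finset.mem_range.1 hj; omega
      rw [this, Q_succ_one, tot_empty, mul_zero]
    · rw [if_neg hv, mul_zero, add_zero, h1]
      refine Finset.sum_congr rfl fun j hj => ?_
      have : n + 1 - j = (n - j) + 1 := by have := Finset.mem_range.1 hj; omega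
      rw [this, Q_succ _ _ hv]

lemma renewal (h : Sym2 ℕ → ℂ) (hl : Light h) (n : ℕ) :
    bC h (n + 1) = ∑ j ∈ Finset.range (n + 1 + 1), bC h j * cC h (n + 1 - j) := by
  rw [bC_eq_tot, pre_step h hl n (renewal_gen h hl n), Finset.sum_range_succ _ (n + 1),
    Nat.sub_self, cC_zero, mul_zero, add_zero]
  refine Finset.sum_congr rfl fun j hj => ?_
  have : n + 1 - j = (n - j) + 1 := by have := Finset.mem_range.1 hj; omega
  rw [this, cC_eq_tot, Wc_succ]

lemma summable_pow (f : ℕ → ℂ) (l : ℂ)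
    (hf : Tendsto (fun n => ∑ j ∈ Finset.range n, f j) atTop (nhds l)) (x : ℂ) (hx : ‖x‖ < 1) :
    Summable fun n => ‖f n * x ^ n‖ := by
  have h1 : Tendsto f atTop (nhds 0) := by
    have := (hf.comp (tendsto_add_atTop_nat 1)).sub hf
    simpa [Function.comp_def, Finset.sum_range_succ] using this
  obtain ⟨M, hM⟩ := h1.norm.bddAbove_range
  refine Summable.of_nonneg_of_le (fun n => norm_nonneg _) (fun n => ?_)
    ((summable_geometric_of_lt_one (norm_nonneg x) hx).mul_left M)
  rw [norm_mul, norm_pow]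
  gcongr
  exact hM ⟨n, rfl⟩

lemma abel_renewal (b c : ℕ → ℂ) (B C : ℂ) (hb0 : b 0 = 1) (hc0 : c 0 = 0)
    (hren : ∀ n, b (n + 1) = ∑ j ∈ Finset.range (n + 1 + 1), b j * c (n + 1 - j))
    (hB : Tendsto (fun n => ∑ j ∈ Finset.range n, b j) atTop (nhds B))
    (hC : Tendsto (fun n => ∑ j ∈ Finset.range n, c j) atTop (nhds C)) : B = 1 + B * C := by
  have tB := tendsto_map'_iff.1 (Complex.tendsto_tsum_powerSeries_nhdsWithin_lt hB)
  have tC := tendsto_map'_iff.1 (Complex.tendsto_tsum_powerSeries_nhdsWithin_lt hC)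
  refine tendsto_nhds_unique tB (((tB.mul tC).const_add 1).congr' ?_)
  have hx0 : ∀ᶠ x : ℝ in nhdsWithin 1 (Set.Iio 1), 0 < x :=
    nhdsWithin_le_nhds (Ioi_mem_nhds zero_lt_one)
  filter_upwards [hx0, self_mem_nhdsWithin] with x hx hx1
  have hn : ‖(x : ℂ)‖ < 1 := by
    rw [Complex.norm_real, Real.norm_of_nonneg hx.le]; exact hx1
  have sb := summable_pow b B hB x hn
  have sc := summable_pow c C hC x hn
  have hp := hasSum_sum_range_mul_of_summable_norm sb sc
  have hq := (hasSum_ite_eq (0 : ℕ) (1 : ℂ)).add hp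
  simp only [Function.comp_apply]
  rw [← hq.tsum_eq]
  refine tsum_congr fun n => ?_
  cases n with
  | zero => simp [hb0, hc0]
  | succ n =>
    rw [hren, Finset.sum_mul, if_neg (Nat.succ_ne_zero n), zero_add]
    refine Finset.sum_congr rfl fun j hj => ?_
    have : n + 1 = j + (n + 1 - j) := by have := Finset.mem_range.1 hj; omega
    rw [mul_mul_mul_comm, ← pow_add, ← this]

/-- Pólya-type theorem (`v = 1`, convex, `U(1)₁`): for a convex light weight `h`, if the
Abel limits `B_h(1)₁` and `C_h(1)₁` exist, then `B_h(1)₁ ≠ 0` and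
`lim_n h(W(1,n)) = 1 − 1/B_h(1)₁`. -/
theorem stmt18 (h : Sym2 ℕ → ℂ) (hlight : Light h) (hconv : ConvexWeight h)
    (B1 C1 : ℂ)
    (hB : Tendsto (fun n => ∑ j ∈ Finset.range (n + 1), bC h j) atTop (nhds B1))
    (hC : Tendsto (fun n => ∑ j ∈ Finset.range (n + 1), cC h j) atTop (nhds C1)) :
    B1 ≠ 0 ∧ Tendsto (fun n => aC h n) atTop (nhds (1 - 1 / B1)) := by

  have hB' := (tendsto_add_atTop_iff_nat (f := fun n => ∑ j ∈ Finset.range n, bC h j) 1).1 hB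
  have hC' := (tendsto_add_atTop_iff_nat (f := fun n => ∑ j ∈ Finset.range n, cC h j) 1).1 hC
  have key := abel_renewal (bC h) (cC h) B1 C1 (bC_zero h) (cC_zero h) (renewal h hlight) hB' hC'
  have hne : B1 ≠ 0 := by
    rintro rfl
    simp at key
  refine ⟨hne, ?_⟩
  have e : 1 - 1 / B1 = C1 := by
    field_simp
    linear_combination key
  rw [e]
  exact hC.congr fun n => (aC_eq h hlight hconv n).symm
end
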